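/- Under assumption (A4), for every t ≥ 1 the AdaGrad-Norm accumulator satisfies E[√v_t] ≤ √2·‖σ‖_p·t^{1/p} + E[√(2u_t)], where u_t = ∑_{s=1}^t ‖∇f(x_s)‖₂². -/

import Mathlib

open MeasureTheory Finset

/-- The AdaGrad-Norm accumulator `v_t = ∑_{s=1}^t ‖g_s‖₂²`. -/
noncomputable def adaNormV {Ω : Type} {d : ℕ} (g : ℕ → Ω → EuclideanSpace ℝ (Fin d))
    (t : ℕ) (ω : Ω) : ℝ :=
  ∑ s ∈ Finset.Icc 1 t, ‖g s ω‖ ^ 2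

/-- The natural filtration `F_t = σ(g_1, …, g_t)`. -/
noncomputable def natFilt {Ω : Type} [MeasurableSpace Ω] {d : ℕ}
    (g : ℕ → Ω → EuclideanSpace ℝ (Fin d)) (t : ℕ) : MeasurableSpace Ω :=
  ⨆ s ∈ Finset.Icc 1 t, MeasurableSpace.comap (g s) inferInstance

/-- Comparison of the `ℓ²` and `ℓᵖ` norms of a finite family for `0 < p ≤ 2`. -/
theorem sqrt_sum_sq_le_rpow_sum_abs_rpow {ι : Type*} (s : Finset ι) (a : ι → ℝ) {p : ℝ}
    (hp : 0 < p) (hp2 : p ≤ 2) :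
    √(∑ i ∈ s, a i ^ 2) ≤ (∑ i ∈ s, |a i| ^ p) ^ (1 / p) := by
  set S := ∑ i ∈ s, |a i| ^ p with hS
  have hS0 : 0 ≤ S := Finset.sum_nonneg fun i _ => by positivity
  have hle : ∀ i ∈ s, |a i| ≤ S ^ (1 / p) := fun i hi => by
    have h := Finset.single_le_sum (f := fun i => |a i| ^ p) (fun j _ => by positivity) hi
    calc |a i| = (|a i| ^ p) ^ (1 / p) := by
          rw [one_div, Real.rpow_rpow_inv (abs_nonneg _) hp.ne']
      _ ≤ S ^ (1 / p) := by gcongr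
  apply Real.sqrt_le_iff.2 ⟨by positivity, ?_⟩
  calc ∑ i ∈ s, a i ^ 2 ≤ ∑ i ∈ s, |a i| ^ p * (S ^ (1 / p)) ^ (2 - p) := by
        refine Finset.sum_le_sum fun i hi => ?_
        have h2 : a i ^ 2 = |a i| ^ p * |a i| ^ (2 - p) := by
          rw [← Real.rpow_add' (abs_nonneg _) (by norm_num), ← sq_abs, ← Real.rpow_natCast]
          norm_num
        rw [h2]
        exact mul_le_mul_of_nonneg_left
          (Real.rpow_le_rpow (abs_nonneg _) (hle i hi) (by linarith)) (by positivity)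
    _ = (S ^ (1 / p)) ^ p * (S ^ (1 / p)) ^ (2 - p) := by
        rw [← Finset.sum_mul, ← hS, one_div, Real.rpow_inv_rpow hS0 hp.ne']
    _ = (S ^ (1 / p)) ^ 2 := by
        rw [← Real.rpow_add' (by positivity) (by norm_num), ← Real.rpow_natCast]
        norm_num

theorem sqrt_sum_norm_sq_le {ι E : Type*} [SeminormedAddCommGroup E] (s : Finset ι)
    (a b : ι → E) :
    √(∑ i ∈ s, ‖a i‖ ^ 2) ≤
      √2 * √(∑ i ∈ s, ‖a i - b i‖ ^ 2) + √(2 * ∑ i ∈ s, ‖b i‖ ^ 2) := by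
  rw [← Real.sqrt_mul zero_le_two]
  have hsub : ∀ y z : ℝ, 0 ≤ y → 0 ≤ z → √(y + z) ≤ √y + √z := fun y z hy hz =>
    Real.sqrt_le_iff.2 ⟨by positivity, by
      nlinarith [Real.sq_sqrt hy, Real.sq_sqrt hz, Real.sqrt_nonneg y, Real.sqrt_nonneg z]⟩
  refine le_trans (Real.sqrt_le_sqrt ?_) (hsub _ _ (by positivity) (by positivity))
  rw [Finset.mul_sum, Finset.mul_sum, ← Finset.sum_add_distrib]
  refine Finset.sum_le_sum fun i _ => ?_
  have h : ‖a i‖ ≤ ‖a i - b i‖ + ‖b i‖ := by simpa using norm_add_le (a i - b i) (b i)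
  nlinarith [norm_nonneg (a i), sq_nonneg (‖a i - b i‖ - ‖b i‖)]

theorem integrable_rpow_of_le_one {Ω : Type*} [MeasurableSpace Ω] {μ : Measure Ω}
    [IsFiniteMeasure μ] {W : Ω → ℝ} (hW : Integrable W μ) (hW0 : ∀ ω, 0 ≤ W ω) {q : ℝ}
    (hq0 : 0 ≤ q) (hq1 : q ≤ 1) : Integrable (fun ω => W ω ^ q) μ := by
  refine ((integrable_const (1 : ℝ)).add hW).mono'
    (hW.aestronglyMeasurable.aemeasurable.pow_const q).aestronglyMeasurable
    (.of_forall fun ω => ?_)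
  rw [Real.norm_of_nonneg (Real.rpow_nonneg (hW0 ω) q)]
  calc W ω ^ q ≤ (1 + W ω) ^ q := by
        gcongr
        · exact hW0 ω
        · linarith
    _ ≤ (1 + W ω) ^ (1 : ℝ) := Real.rpow_le_rpow_of_exponent_le (by linarith [hW0 ω]) hq1
    _ = 1 + W ω := Real.rpow_one _

/-- Jensen's inequality for the concave power functions. -/
theorem integral_rpow_le_rpow_integral {Ω : Type*} [MeasurableSpace Ω] {μ : Measure Ω}
    [IsProbabilityMeasure μ] {W : Ω → ℝ} (hW : Integrable W μ) (hW0 : ∀ ω, 0 ≤ W ω) {q : ℝ}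
    (hq0 : 0 ≤ q) (hq1 : q ≤ 1) : ∫ ω, W ω ^ q ∂μ ≤ (∫ ω, W ω ∂μ) ^ q :=
  (Real.concaveOn_rpow hq0 hq1).le_map_integral
    (Real.continuous_rpow_const hq0).continuousOn isClosed_Ici (.of_forall hW0) hW
    (integrable_rpow_of_le_one hW hW0 hq0 hq1)

theorem natFilt_le {Ω : Type} [m : MeasurableSpace Ω] {d : ℕ}
    {g : ℕ → Ω → EuclideanSpace ℝ (Fin d)} (hg : ∀ t, Measurable (g t)) (t : ℕ) :
    natFilt g t ≤ m :=
  iSup₂_le fun s _ => (hg s).comap_le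

theorem measurable_of_hasGradientAt {F : Type*} [NormedAddCommGroup F] [InnerProductSpace ℝ F]
    [CompleteSpace F] [MeasurableSpace F] [BorelSpace F]
    {f : F → ℝ} {f' : F → F} (h : ∀ y, HasGradientAt f (f' y) y) : Measurable f' := by
  borelize (StrongDual ℝ F)
  have hf' : f' = fun y => (InnerProductSpace.toDual ℝ F).symm (fderiv ℝ f y) := by
    funext y
    rw [(h y).hasFDerivAt.fderiv, LinearIsometryEquiv.symm_apply_apply]
  rw [hf']
  exact (InnerProductSpace.toDual ℝ F).symm.continuous.measurable.comp (measurable_fderiv ℝ f)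

theorem measurable_adaNormV {Ω : Type} [MeasurableSpace Ω] {d : ℕ}
    {g : ℕ → Ω → EuclideanSpace ℝ (Fin d)} (hg : ∀ t, Measurable (g t)) (t : ℕ) :
    Measurable (adaNormV g t) :=
  Finset.measurable_fun_sum _ fun s _ => (hg s).norm.pow_const 2

/-- The real-valued bound `A ≤ B + C` integrates even when the Bochner integral of `C` takes its
default value, as long as integrability of `A` forces that of `C`. -/
theorem integral_le_integral_add_integral {Ω : Type*} [MeasurableSpace Ω] {μ : Measure Ω}
    {A B C : Ω → ℝ} (hB : Integrable B μ) (hB0 : ∀ ω, 0 ≤ B ω) (hA0 : ∀ ω, 0 ≤ A ω)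
    (hle : ∀ ω, A ω ≤ B ω + C ω) (hAC : Integrable A μ → Integrable C μ) :
    ∫ ω, A ω ∂μ ≤ ∫ ω, B ω ∂μ + ∫ ω, C ω ∂μ := by
  by_cases hC : Integrable C μ
  · rw [← integral_add hB hC]
    exact integral_mono_of_nonneg (.of_forall hA0) (hB.add hC) (.of_forall hle)
  · rw [integral_undef hC, integral_undef (mt hAC hC), add_zero]
    exact integral_nonneg hB0

/-- under the heavy-tailed noise assumption (A4), for every `t ≥ 1`
the AdaGrad-Norm accumulator satisfies
`E[√v_t] ≤ √2·‖σ‖_p·t^{1/p} + E[√(2 u_t)]` with `u_t = ∑_{s=1}^t ‖∇f(x_s)‖₂²`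
and `‖σ‖_p = (∑_i σ_i^p)^{1/p}`. -/
theorem adagradNorm_accumulator_bound
    (d : ℕ) (Ω : Type) [MeasurableSpace Ω] (μ : Measure Ω) [IsProbabilityMeasure μ]
    (f : EuclideanSpace ℝ (Fin d) → ℝ)
    (gradf : EuclideanSpace ℝ (Fin d) → EuclideanSpace ℝ (Fin d))
    (g x : ℕ → Ω → EuclideanSpace ℝ (Fin d)) (x₁ : EuclideanSpace ℝ (Fin d))
    (γ lam p : ℝ) (σ : Fin d → ℝ)
    (hγ : 0 < γ) (hlam : 0 < lam)
    (hgrad : ∀ y, HasGradientAt f (gradf y) y)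
    (hgmeas : ∀ t, Measurable (g t))
    (hx1 : ∀ ω, x 1 ω = x₁)
    (hxupd : ∀ t, 1 ≤ t → ∀ ω,
      x (t + 1) ω = x t ω - (γ / (lam + Real.sqrt (adaNormV g t ω))) • g t ω)
    (hp1 : 1 < p) (hp2 : p ≤ 2) (hσ : ∀ i, 0 ≤ σ i)
    (hnoise : ∀ t, 1 ≤ t → ∀ i : Fin d,
      Integrable (fun ω => |g t ω i - gradf (x t ω) i| ^ p) μ ∧
      ∀ᵐ ω ∂μ,
        (μ[(fun ω' => |g t ω' i - gradf (x t ω') i| ^ p) | natFilt g (t - 1)]) ω ≤ σ i ^ p) :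
    ∀ t : ℕ, 1 ≤ t →
      (∫ ω, Real.sqrt (adaNormV g t ω) ∂μ) ≤
        Real.sqrt 2 * (∑ i, σ i ^ p) ^ (1 / p) * (t : ℝ) ^ (1 / p) +
          ∫ ω, Real.sqrt (2 * ∑ s ∈ Finset.Icc 1 t, ‖gradf (x s ω)‖ ^ 2) ∂μ := by
  intro t ht
  have hp0 : 0 < p := by linarith
  have hq0 : 0 ≤ 1 / p := by positivity
  have hq1 : 1 / p ≤ 1 := (div_le_one hp0).2 hp1.le
  have hgradm : Measurable gradf := measurable_of_hasGradientAt hgrad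
  have hxm : ∀ s, 1 ≤ s → Measurable (x s) := by
    intro s hs
    induction s, hs using Nat.le_induction with
    | base => rw [show x 1 = fun _ => x₁ from funext hx1]; exact measurable_const
    | succ s hs ih =>
      rw [show x (s + 1) = _ from funext (hxupd s hs)]
      exact ih.sub
        ((((measurable_adaNormV hgmeas s).sqrt.const_add lam).const_div γ).smul (hgmeas s))
  set J : Finset (ℕ × Fin d) := Finset.Icc 1 t ×ˢ Finset.univ
  set W : Ω → ℝ := fun ω => ∑ j ∈ J, |g j.1 ω j.2 - gradf (x j.1 ω) j.2| ^ p with hWdef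
  have hJ : ∀ j ∈ J, 1 ≤ j.1 := fun j hj =>
    (Finset.mem_Icc.1 (Finset.mem_product.1 hj).1).1
  have hW : Integrable W μ := integrable_finsetSum _ fun j hj => (hnoise j.1 (hJ j hj) j.2).1
  have hW0 : ∀ ω, 0 ≤ W ω := fun ω => Finset.sum_nonneg fun j _ => by positivity
  have hterm : ∀ s, 1 ≤ s → ∀ i, ∫ ω, |g s ω i - gradf (x s ω) i| ^ p ∂μ ≤ σ i ^ p := by
    intro s hs i
    rw [← integral_condExp (natFilt_le hgmeas (s - 1))]
    simpa using integral_mono_ae integrable_condExp (integrable_const (σ i ^ p)) (hnoise s hs i).2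
  have hWint : ∫ ω, W ω ∂μ ≤ (∑ i, σ i ^ p) * t := by
    rw [hWdef, integral_finsetSum _ fun j hj => (hnoise j.1 (hJ j hj) j.2).1]
    refine (Finset.sum_le_sum fun j hj => hterm j.1 (hJ j hj) j.2).trans_eq ?_
    rw [Finset.sum_product]
    simp [mul_comm]
  have hnoiseW : ∀ ω, √(∑ s ∈ Finset.Icc 1 t, ‖g s ω - gradf (x s ω)‖ ^ 2) ≤ W ω ^ (1 / p) := by
    intro ω
    refine le_trans (le_of_eq ?_) (sqrt_sum_sq_le_rpow_sum_abs_rpow J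
      (fun j => g j.1 ω j.2 - gradf (x j.1 ω) j.2) hp0 hp2)
    rw [Finset.sum_product]
    simp [EuclideanSpace.real_norm_sq_eq]
  have hWp : Integrable (fun ω => W ω ^ (1 / p)) μ := integrable_rpow_of_le_one hW hW0 hq0 hq1
  have hσ0 : 0 ≤ ∑ i, σ i ^ p := Finset.sum_nonneg fun i _ => Real.rpow_nonneg (hσ i) p
  have hmain : ∀ ω, √(adaNormV g t ω) ≤ √2 * W ω ^ (1 / p) +
      √(2 * ∑ s ∈ Finset.Icc 1 t, ‖gradf (x s ω)‖ ^ 2) := by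
    intro ω
    refine (sqrt_sum_norm_sq_le (Finset.Icc 1 t) (fun s => g s ω)
      (fun s => gradf (x s ω))).trans ?_
    gcongr
    exact hnoiseW ω
  have hrev : Integrable (fun ω => √(adaNormV g t ω)) μ →
      Integrable (fun ω => √(2 * ∑ s ∈ Finset.Icc 1 t, ‖gradf (x s ω)‖ ^ 2)) μ := by
    intro hA
    refine (((hWp.const_mul √2).add (hA.const_mul √2)).const_mul √2).mono' ?_
      (.of_forall fun ω => ?_)
    · exact ((Finset.measurable_fun_sum _ fun s hs => ((hgradm.comp
        (hxm s (Finset.mem_Icc.1 hs).1)).norm.pow_const 2)).const_mul 2).sqrt.aestronglyMeasurable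
    · rw [Real.norm_of_nonneg (Real.sqrt_nonneg _), Real.sqrt_mul zero_le_two]
      have h := sqrt_sum_norm_sq_le (Finset.Icc 1 t) (fun s => gradf (x s ω)) (fun s => g s ω)
      simp_rw [norm_sub_rev (gradf _)] at h
      rw [Real.sqrt_mul zero_le_two (∑ s ∈ Finset.Icc 1 t, ‖g s ω‖ ^ 2)] at h
      refine mul_le_mul_of_nonneg_left (h.trans ?_) (Real.sqrt_nonneg _)
      exact add_le_add_left (mul_le_mul_of_nonneg_left (hnoiseW ω) (Real.sqrt_nonneg _)) _
  refine (integral_le_integral_add_integral (hWp.const_mul √2)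
    (fun ω => mul_nonneg (Real.sqrt_nonneg _) (Real.rpow_nonneg (hW0 ω) _))
    (fun ω => Real.sqrt_nonneg _) hmain hrev).trans (add_le_add_left ?_ _)
  rw [integral_const_mul, mul_assoc, ← Real.mul_rpow hσ0 (Nat.cast_nonneg t)]
  refine mul_le_mul_of_nonneg_left ?_ (Real.sqrt_nonneg _)
  exact (integral_rpow_le_rpow_integral hW hW0 hq0 hq1).trans
    (Real.rpow_le_rpow (integral_nonneg hW0) hWint hq0)
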